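/- arXiv:2406.07652 — 2 statements merged into one kernel-verified Lean document; each statement's English description precedes it below -/
import Mathlib

section
/- Fix η ∈ [0,1]. For all θ ∈ [0,π] and δφ ∈ ℝ, define d_α = η sinθ [η sinθ (1 − η² sin² δφ) − (−1)^α 2η cos δφ] + η² for α = 0,1. Then d₀ ≥ 0, d₁ ≥ 0, and (1/2)(√d₀ + √d₁) ≤ η√(2 − η²), with equality attained at θ = π/2, δφ = π/2 (and at θ = π/2, δφ = −π/2). Moreover, at these maximizers the second-round direction n̂(π/2, φ₁ ∓ π/2) is orthogonal (zero Euclidean dot product in ℝ³) to the first-round direction n̂(π/2, φ₁). -/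
noncomputable section

/-- The quantity `d_α = η sinθ [η sinθ (1 − η² sin² δφ) − (−1)^α 2η cos δφ] + η²`. -/
def dval (η θ δφ : ℝ) (α : ℕ) : ℝ :=
  η * Real.sin θ * (η * Real.sin θ * (1 - η ^ 2 * Real.sin δφ ^ 2) -
    (-1 : ℝ) ^ α * (2 * η * Real.cos δφ)) + η ^ 2

/-- The unit direction `n̂(θ,φ) = (sinθ cosφ, sinθ sinφ, cosθ)` in ℝ³. -/
def nhat (θ φ : ℝ) : Fin 3 → ℝ :=
  ![Real.sin θ * Real.cos φ, Real.sin θ * Real.sin φ, Real.cos θ]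

/-- Euclidean dot product in ℝ³. -/
def dot3 (u v : Fin 3 → ℝ) : ℝ := ∑ i, u i * v i

theorem dval_zero (η θ δφ : ℝ) : dval η θ δφ 0 =
    η ^ 2 * (1 + Real.sin θ ^ 2 * (1 - η ^ 2 * Real.sin δφ ^ 2)
      - 2 * (Real.sin θ * Real.cos δφ)) := by
  unfold dval; ring

theorem dval_one (η θ δφ : ℝ) : dval η θ δφ 1 =
    η ^ 2 * (1 + Real.sin θ ^ 2 * (1 - η ^ 2 * Real.sin δφ ^ 2)
      + 2 * (Real.sin θ * Real.cos δφ)) := by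
  unfold dval; ring

theorem half_sqrt_add_sqrt_le {a x m : ℝ} (h₀ : 0 ≤ a - 2 * x) (h₁ : 0 ≤ a + 2 * x)
    (ha : a ≤ 2 * m) (h : 0 ≤ m ^ 2 - m * a + x ^ 2) :
    (1/2) * (√(a - 2 * x) + √(a + 2 * x)) ≤ √m := by
  apply Real.le_sqrt_of_sq_le
  have hprod : √(a - 2 * x) * √(a + 2 * x) ≤ 2 * m - a := by
    refine abs_le_of_sq_le_sq' ?_ (by linarith) |>.2
    rw [mul_pow, Real.sq_sqrt h₀, Real.sq_sqrt h₁]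
    nlinarith
  nlinarith [Real.sq_sqrt h₀, Real.sq_sqrt h₁]

theorem sqrt_dval_bound {η s c S : ℝ} (hη0 : 0 ≤ η) (hη1 : η ≤ 1) (hs : s ^ 2 ≤ 1)
    (hS : S ^ 2 + c ^ 2 = 1) :
    0 ≤ 1 + s ^ 2 * (1 - η ^ 2 * S ^ 2) - 2 * (s * c) ∧
    0 ≤ 1 + s ^ 2 * (1 - η ^ 2 * S ^ 2) + 2 * (s * c) ∧
    (1/2) * (√(1 + s ^ 2 * (1 - η ^ 2 * S ^ 2) - 2 * (s * c)) +
      √(1 + s ^ 2 * (1 - η ^ 2 * S ^ 2) + 2 * (s * c))) ≤ √(2 - η ^ 2) := by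
  have hu : 0 ≤ 1 - η ^ 2 := by nlinarith
  have hS' : S ^ 2 = 1 - c ^ 2 := by linarith
  have hn : 0 ≤ s ^ 2 * S ^ 2 * (1 - η ^ 2) := by positivity
  have h₀ : 0 ≤ 1 + s ^ 2 * (1 - η ^ 2 * S ^ 2) - 2 * (s * c) := by
    have : 1 + s ^ 2 * (1 - η ^ 2 * S ^ 2) - 2 * (s * c) =
        (1 - s * c) ^ 2 + s ^ 2 * S ^ 2 * (1 - η ^ 2) := by rw [hS']; ring
    rw [this]; positivity
  have h₁ : 0 ≤ 1 + s ^ 2 * (1 - η ^ 2 * S ^ 2) + 2 * (s * c) := by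
    have : 1 + s ^ 2 * (1 - η ^ 2 * S ^ 2) + 2 * (s * c) =
        (1 + s * c) ^ 2 + s ^ 2 * S ^ 2 * (1 - η ^ 2) := by rw [hS']; ring
    rw [this]; positivity
  refine ⟨h₀, h₁, half_sqrt_add_sqrt_le h₀ h₁ ?_ ?_⟩
  · have : 0 ≤ s ^ 2 * (η ^ 2 * S ^ 2) := by positivity
    linarith
  · have : (2 - η ^ 2) ^ 2 - (2 - η ^ 2) * (1 + s ^ 2 * (1 - η ^ 2 * S ^ 2)) + (s * c) ^ 2 =
        (1 + (1 - η ^ 2)) * (1 - η ^ 2) * (1 - s ^ 2) + (1 - η ^ 2) ^ 2 * (s * c) ^ 2 := by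
      rw [hS']; ring
    rw [this]
    have : 0 ≤ 1 - s ^ 2 := by linarith
    positivity

/-- fix η ∈ [0,1]. For all θ ∈ [0,π] and δφ ∈ ℝ one has `d₀ ≥ 0`,
`d₁ ≥ 0`, and `(1/2)(√d₀ + √d₁) ≤ η√(2 − η²)`, with equality attained at
`θ = π/2, δφ = ±π/2`. Moreover, at these maximizers the second-round direction
`n̂(π/2, φ₁ ∓ π/2)` is orthogonal to the first-round direction `n̂(π/2, φ₁)`. -/
theorem stmt9 (η : ℝ) (hη0 : 0 ≤ η) (hη1 : η ≤ 1) :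
    (∀ θ ∈ Set.Icc (0 : ℝ) Real.pi, ∀ δφ : ℝ,
      0 ≤ dval η θ δφ 0 ∧ 0 ≤ dval η θ δφ 1 ∧
      (1/2) * (Real.sqrt (dval η θ δφ 0) + Real.sqrt (dval η θ δφ 1)) ≤
        η * Real.sqrt (2 - η ^ 2)) ∧
    (1/2) * (Real.sqrt (dval η (Real.pi / 2) (Real.pi / 2) 0) +
        Real.sqrt (dval η (Real.pi / 2) (Real.pi / 2) 1)) =
      η * Real.sqrt (2 - η ^ 2) ∧
    (1/2) * (Real.sqrt (dval η (Real.pi / 2) (-(Real.pi / 2)) 0) +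
        Real.sqrt (dval η (Real.pi / 2) (-(Real.pi / 2)) 1)) =
      η * Real.sqrt (2 - η ^ 2) ∧
    (∀ φ₁ : ℝ,
      dot3 (nhat (Real.pi / 2) (φ₁ - Real.pi / 2)) (nhat (Real.pi / 2) φ₁) = 0 ∧
      dot3 (nhat (Real.pi / 2) (φ₁ + Real.pi / 2)) (nhat (Real.pi / 2) φ₁) = 0) := by
  have hsqrt (y : ℝ) : √(η ^ 2 * y) = η * √y := by
    rw [Real.sqrt_mul (sq_nonneg η), Real.sqrt_sq hη0]
  refine ⟨fun θ _ δφ => ?_, ?_, ?_, fun φ₁ => ⟨?_, ?_⟩⟩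
  · obtain ⟨h₀, h₁, h⟩ := sqrt_dval_bound hη0 hη1 (Real.sin_sq_le_one θ)
      (Real.sin_sq_add_cos_sq δφ)
    rw [dval_zero, dval_one, hsqrt, hsqrt]
    refine ⟨by positivity, by positivity, ?_⟩
    calc _ = η * _ := by rw [← mul_add, mul_left_comm]
      _ ≤ _ := mul_le_mul_of_nonneg_left h hη0
  · rw [dval_zero, dval_one, hsqrt, hsqrt]
    simp only [Real.sin_pi_div_two, Real.cos_pi_div_two]
    ring_nf
  · rw [dval_zero, dval_one, hsqrt, hsqrt]
    simp only [Real.sin_neg, Real.cos_neg, Real.sin_pi_div_two, Real.cos_pi_div_two]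
    ring_nf
  · simp [dot3, nhat, Fin.sum_univ_three, Real.sin_sub_pi_div_two, Real.cos_sub_pi_div_two]
    ring
  · simp [dot3, nhat, Fin.sum_univ_three, Real.sin_add_pi_div_two, Real.cos_add_pi_div_two]
    ring
end
end

section
/- Let |gGHZ⟩ = c0|000⟩ + c1|111⟩ with |c0|² + |c1|² = 1 and c0 c1 ≠ 0. For every η with 0 ≤ η < 1, every λ ∈ {+1,−1}, and every direction (θ, φ), the post-measured three-qubit pure state |Ψ_λ⟩ = (I⊗I⊗M(λ, ηn̂(θ,φ)))|gGHZ⟩ / ‖(I⊗I⊗M(λ, ηn̂(θ,φ)))|gGHZ⟩‖ is entangled across the bipartition (qubits 1,2) : (qubit 3): its reduced density matrix on qubit 3 has rank 2, equivalently purity Tr(ρ₃²) < 1. In contrast, for η = 1 the post-measured state is a product state across this cut (ρ₃ is pure). -/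
open Matrix

noncomputable section

/-- The state `|χ+⟩ = cos(θ/2)|0⟩ + e^{iφ} sin(θ/2)|1⟩`. -/
def chiP (θ φ : ℝ) : Fin 2 → ℂ :=
  ![(Real.cos (θ/2) : ℂ), Complex.exp (φ * Complex.I) * (Real.sin (θ/2) : ℂ)]

/-- The state `|χ−⟩ = sin(θ/2)|0⟩ − e^{iφ} cos(θ/2)|1⟩`. -/
def chiM (θ φ : ℝ) : Fin 2 → ℂ :=
  ![(Real.sin (θ/2) : ℂ), -(Complex.exp (φ * Complex.I) * (Real.cos (θ/2) : ℂ))]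

/-- The outer product `|v⟩⟨v|`. -/
def outer (v : Fin 2 → ℂ) : Matrix (Fin 2) (Fin 2) ℂ := vecMulVec v (star v)

/-- The measurement operator `M(λ, η n̂(θ,φ)) = √((1+λη)/2)|χ+⟩⟨χ+| + √((1−λη)/2)|χ−⟩⟨χ−|`. -/
def Mop (lam η θ φ : ℝ) : Matrix (Fin 2) (Fin 2) ℂ :=
  ((Real.sqrt ((1 + lam * η) / 2) : ℝ) : ℂ) • outer (chiP θ φ) +
    ((Real.sqrt ((1 - lam * η) / 2) : ℝ) : ℂ) • outer (chiM θ φ)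

/-- The operator `I ⊗ I ⊗ M` acting on three qubits (measurement on qubit 3). -/
def op3 (M : Matrix (Fin 2) (Fin 2) ℂ) :
    Matrix (Fin 2 × Fin 2 × Fin 2) (Fin 2 × Fin 2 × Fin 2) ℂ :=
  fun p q => (if p.1 = q.1 then 1 else 0) * (if p.2.1 = q.2.1 then 1 else 0) * M p.2.2 q.2.2

/-- The generalized GHZ state `c0|000⟩ + c1|111⟩`. -/
def ghzV (c0 c1 : ℂ) : Fin 2 × Fin 2 × Fin 2 → ℂ :=
  fun p => if p = (0, 0, 0) then c0 else if p = (1, 1, 1) then c1 else 0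

/-- Squared norm of a vector. -/
def nsq {n : Type*} [Fintype n] (v : n → ℂ) : ℝ := ∑ i, Complex.normSq (v i)

/-- Partial trace over qubits 1 and 2 of a three-qubit matrix, giving the reduced
density matrix on qubit 3. -/
def ptrace12 (ρ : Matrix (Fin 2 × Fin 2 × Fin 2) (Fin 2 × Fin 2 × Fin 2) ℂ) :
    Matrix (Fin 2) (Fin 2) ℂ :=
  fun i j => ∑ p : Fin 2 × Fin 2, ρ (p.1, p.2, i) (p.1, p.2, j)

/-- The (unnormalized) post-measured vector `(I⊗I⊗M(λ, η n̂(θ,φ)))|gGHZ⟩`. -/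
def postVec (c0 c1 : ℂ) (lam η θ φ : ℝ) : Fin 2 × Fin 2 × Fin 2 → ℂ :=
  (op3 (Mop lam η θ φ)).mulVec (ghzV c0 c1)

/-- The reduced density matrix on qubit 3 of the normalized post-measured state
`|Ψ_λ⟩ = (I⊗I⊗M)|gGHZ⟩ / ‖(I⊗I⊗M)|gGHZ⟩‖`. -/
def rho3 (c0 c1 : ℂ) (lam η θ φ : ℝ) : Matrix (Fin 2) (Fin 2) ℂ :=
  ((nsq (postVec c0 c1 lam η θ φ) : ℝ) : ℂ)⁻¹ •
    ptrace12 (vecMulVec (postVec c0 c1 lam η θ φ) (star (postVec c0 c1 lam η θ φ)))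

/-- The matrix of amplitudes `c_k M_{ik}` of the post-measured vector. -/
def ampl (c0 c1 : ℂ) (M : Matrix (Fin 2) (Fin 2) ℂ) : Matrix (Fin 2) (Fin 2) ℂ :=
  M * diagonal ![c0, c1]

lemma ptrace12_op3_mulVec_ghzV (c0 c1 : ℂ) (M : Matrix (Fin 2) (Fin 2) ℂ) :
    ptrace12 (vecMulVec ((op3 M).mulVec (ghzV c0 c1)) (star ((op3 M).mulVec (ghzV c0 c1)))) =
      ampl c0 c1 M * (ampl c0 c1 M)ᴴ := by
  ext i j
  simp [ptrace12, op3, ghzV, ampl, mulVec, dotProduct, vecMulVec_apply, mul_apply,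
    Fintype.sum_prod_type, Fin.sum_univ_two, diagonal_apply]
  ring

lemma nsq_op3_mulVec_ghzV (c0 c1 : ℂ) (M : Matrix (Fin 2) (Fin 2) ℂ) :
    ((nsq ((op3 M).mulVec (ghzV c0 c1)) : ℝ) : ℂ) =
      (ampl c0 c1 M * (ampl c0 c1 M)ᴴ).trace := by
  simp [nsq, op3, ghzV, ampl, mulVec, dotProduct, mul_apply, trace, Complex.normSq_eq_conj_mul_self,
    Fintype.sum_prod_type, Fin.sum_univ_two, diagonal_apply]
  ring

lemma chi_det (θ φ : ℝ) :
    chiP θ φ 0 * chiM θ φ 1 - chiP θ φ 1 * chiM θ φ 0 = -Complex.exp (φ * Complex.I) := by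
  have h : (Real.sin (θ / 2) : ℂ) ^ 2 + (Real.cos (θ / 2) : ℂ) ^ 2 = 1 := by
    exact_mod_cast Real.sin_sq_add_cos_sq (θ / 2)
  simp only [chiP, chiM, cons_val_zero, cons_val_one]
  linear_combination -Complex.exp (φ * Complex.I) * h

lemma exp_mul_I_mul_star (φ : ℝ) :
    Complex.exp (φ * Complex.I) * star (Complex.exp (φ * Complex.I)) = 1 := by
  rw [Complex.star_def, Complex.mul_conj, Complex.normSq_eq_norm_sq,
    Complex.norm_exp_ofReal_mul_I]
  simp

lemma det_Mop (lam η θ φ : ℝ) :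
    (Mop lam η θ φ).det =
      (Real.sqrt ((1 + lam * η) / 2) : ℂ) * (Real.sqrt ((1 - lam * η) / 2) : ℂ) := by
  have h := chi_det θ φ
  have h' := congrArg star h
  have he := exp_mul_I_mul_star φ
  simp only [star_sub, star_mul', star_neg] at h'
  rw [det_fin_two]
  simp only [Mop, outer, Matrix.add_apply, Matrix.smul_apply, vecMulVec_apply, Pi.star_apply, smul_eq_mul]
  set a : ℂ := (Real.sqrt ((1 + lam * η) / 2) : ℂ)
  set b : ℂ := (Real.sqrt ((1 - lam * η) / 2) : ℂ)
  linear_combination a * b * (he + (star (chiP θ φ 0) * star (chiM θ φ 1) -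
    star (chiP θ φ 1) * star (chiM θ φ 0)) * h - Complex.exp (φ * Complex.I) * h')

lemma trace_Mop (lam η θ φ : ℝ) :
    (Mop lam η θ φ).trace =
      (Real.sqrt ((1 + lam * η) / 2) : ℂ) + (Real.sqrt ((1 - lam * η) / 2) : ℂ) := by
  have h : (Real.sin (θ / 2) : ℂ) ^ 2 + (Real.cos (θ / 2) : ℂ) ^ 2 = 1 := by
    exact_mod_cast Real.sin_sq_add_cos_sq (θ / 2)
  have he := exp_mul_I_mul_star φ
  rw [trace_fin_two]
  simp only [Mop, outer, Matrix.add_apply, Matrix.smul_apply, vecMulVec_apply, Pi.star_apply, smul_eq_mul,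
    chiP, chiM, cons_val_zero, cons_val_one, star_mul', star_neg, Complex.star_def,
    Complex.conj_ofReal] at he ⊢
  set a : ℂ := (Real.sqrt ((1 + lam * η) / 2) : ℂ)
  set b : ℂ := (Real.sqrt ((1 - lam * η) / 2) : ℂ)
  set s : ℂ := (Real.sin (θ / 2) : ℂ)
  set c : ℂ := (Real.cos (θ / 2) : ℂ)
  linear_combination (a * s ^ 2 + b * c ^ 2) * he + (a + b) * h

lemma Mop_ne_zero {lam η : ℝ} (θ φ : ℝ) : Mop lam η θ φ ≠ 0 := by
  intro h
  have ht := trace_Mop lam η θ φ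
  rw [h, trace_zero] at ht
  have ht' : Real.sqrt ((1 + lam * η) / 2) + Real.sqrt ((1 - lam * η) / 2) = 0 := by
    exact_mod_cast ht.symm
  have h1 := Real.sqrt_nonneg ((1 + lam * η) / 2)
  have h2 := Real.sqrt_nonneg ((1 - lam * η) / 2)
  have h3 := Real.sqrt_eq_zero'.1 (by linarith : Real.sqrt ((1 + lam * η) / 2) = 0)
  have h4 := Real.sqrt_eq_zero'.1 (by linarith : Real.sqrt ((1 - lam * η) / 2) = 0)
  linarith

lemma det_ampl (c0 c1 : ℂ) (M : Matrix (Fin 2) (Fin 2) ℂ) :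
    (ampl c0 c1 M).det = M.det * (c0 * c1) := by
  simp [ampl, det_mul, det_diagonal, Fin.prod_univ_two]

lemma ampl_ne_zero {c0 c1 : ℂ} (hc : c0 * c1 ≠ 0) {M : Matrix (Fin 2) (Fin 2) ℂ} (hM : M ≠ 0) :
    ampl c0 c1 M ≠ 0 := by
  intro h
  apply hM
  have hu : IsUnit (diagonal ![c0, c1]) := by
    rw [isUnit_iff_isUnit_det]
    simpa [det_diagonal, Fin.prod_univ_two] using hc
  exact hu.mul_left_eq_zero.1 h

open scoped ComplexOrder in
lemma trace_ampl_mul_conjTranspose_ne_zero {c0 c1 : ℂ} (hc : c0 * c1 ≠ 0)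
    {M : Matrix (Fin 2) (Fin 2) ℂ} (hM : M ≠ 0) :
    (ampl c0 c1 M * (ampl c0 c1 M)ᴴ).trace ≠ 0 :=
  trace_mul_conjTranspose_self_eq_zero_iff.not.2 (ampl_ne_zero hc hM)

lemma rho3_eq (c0 c1 : ℂ) (lam η θ φ : ℝ) :
    rho3 c0 c1 lam η θ φ =
      (ampl c0 c1 (Mop lam η θ φ) * (ampl c0 c1 (Mop lam η θ φ))ᴴ).trace⁻¹ •
        (ampl c0 c1 (Mop lam η θ φ) * (ampl c0 c1 (Mop lam η θ φ))ᴴ) := by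
  rw [rho3, postVec, nsq_op3_mulVec_ghzV, ptrace12_op3_mulVec_ghzV]

lemma trace_rho3 {c0 c1 : ℂ} (hc : c0 * c1 ≠ 0) (lam η θ φ : ℝ) :
    (rho3 c0 c1 lam η θ φ).trace = 1 := by
  rw [rho3_eq, trace_smul, smul_eq_mul, inv_mul_cancel₀]
  exact trace_ampl_mul_conjTranspose_ne_zero hc (Mop_ne_zero θ φ)

/-- The determinant of `ρ₃` is the squared modulus of `det M · c₀c₁ / ‖M ψ‖²`. -/
lemma det_rho3 (c0 c1 : ℂ) (lam η θ φ : ℝ) :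
    (rho3 c0 c1 lam η θ φ).det =
      (Complex.normSq ((nsq (postVec c0 c1 lam η θ φ) : ℂ)⁻¹ *
        ((Mop lam η θ φ).det * (c0 * c1))) : ℂ) := by
  rw [rho3, postVec, ptrace12_op3_mulVec_ghzV, det_smul, det_mul, det_conjTranspose, det_ampl,
    Complex.normSq_eq_conj_mul_self]
  simp
  ring

lemma trace_mul_self_fin_two {R : Type*} [CommRing R] (A : Matrix (Fin 2) (Fin 2) R) :
    (A * A).trace = A.trace ^ 2 - 2 * A.det := by
  simp only [trace_fin_two, det_fin_two, mul_apply, Fin.sum_univ_two]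
  ring

lemma rank_eq_one_of_det_eq_zero {K : Type*} [Field K] {A : Matrix (Fin 2) (Fin 2) K}
    (hd : A.det = 0) (h0 : A ≠ 0) : A.rank = 1 := by
  have h1 : A.rank ≠ 0 := by
    intro h
    rw [rank, Submodule.finrank_eq_zero, LinearMap.range_eq_bot] at h
    exact h0 (mulVec_injective <| funext fun v => LinearMap.congr_fun h v |>.trans (by simp))
  have h2 : A.rank ≤ 2 := by simpa using A.rank_le_width
  have h3 : A.rank ≠ 2 := by
    intro h
    have ht : LinearMap.range A.mulVecLin = ⊤ :=
      Submodule.eq_top_of_finrank_eq (h.trans (by simp))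
    have hu := mulVec_surjective_iff_isUnit.1 (LinearMap.range_eq_top.1 ht)
    rw [isUnit_iff_isUnit_det, hd] at hu
    exact not_isUnit_zero hu
  omega

/-- for `|gGHZ⟩ = c0|000⟩ + c1|111⟩` with `c0 c1 ≠ 0`, for every
`0 ≤ η < 1`, λ ∈ {+1,−1} and direction (θ, φ), the normalized post-measured state is
entangled across (qubits 1,2):(qubit 3): the reduced state ρ₃ has rank 2, equivalently
purity `Tr(ρ₃²) < 1`. In contrast, for η = 1 the post-measured state is a product
state across this cut: ρ₃ is pure (rank 1, purity `Tr(ρ₃²) = 1`). -/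
theorem stmt15 (c0 c1 : ℂ) (hnorm : Complex.normSq c0 + Complex.normSq c1 = 1)
    (hc : c0 * c1 ≠ 0) (lam : ℝ) (hlam : lam = 1 ∨ lam = -1) (θ φ : ℝ) :
    (∀ η : ℝ, 0 ≤ η → η < 1 →
      (rho3 c0 c1 lam η θ φ).rank = 2 ∧
      ((rho3 c0 c1 lam η θ φ) * (rho3 c0 c1 lam η θ φ)).trace.re < 1) ∧
    ((rho3 c0 c1 lam 1 θ φ).rank = 1 ∧
      ((rho3 c0 c1 lam 1 θ φ) * (rho3 c0 c1 lam 1 θ φ)).trace = 1) := by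
  refine ⟨fun η h0 h1 => ?_, ?_⟩
  · have hdet : (Mop lam η θ φ).det ≠ 0 := by
      rw [det_Mop]
      have hp : 0 < (1 + lam * η) / 2 := by rcases hlam with rfl | rfl <;> linarith
      have hm : 0 < (1 - lam * η) / 2 := by rcases hlam with rfl | rfl <;> linarith
      exact_mod_cast (mul_pos (Real.sqrt_pos.2 hp) (Real.sqrt_pos.2 hm)).ne'
    have hN : (nsq (postVec c0 c1 lam η θ φ) : ℂ) ≠ 0 := by
      rw [postVec, nsq_op3_mulVec_ghzV]
      exact trace_ampl_mul_conjTranspose_ne_zero hc (Mop_ne_zero θ φ)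
    have hpos := Complex.normSq_pos.2 (mul_ne_zero (inv_ne_zero hN) (mul_ne_zero hdet hc))
    have hrho := det_rho3 c0 c1 lam η θ φ
    constructor
    · have hu : IsUnit (rho3 c0 c1 lam η θ φ) := by
        rw [isUnit_iff_isUnit_det, hrho, isUnit_iff_ne_zero]
        exact_mod_cast hpos.ne'
      simpa using rank_of_isUnit _ hu
    · rw [trace_mul_self_fin_two, trace_rho3 hc, hrho]
      generalize Complex.normSq _ = x at hpos
      simp
      linarith
  · have hdet : (rho3 c0 c1 lam 1 θ φ).det = 0 := by
      rw [det_rho3, det_Mop]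
      rcases hlam with rfl | rfl <;> simp
    have htr := trace_rho3 hc lam 1 θ φ
    refine ⟨rank_eq_one_of_det_eq_zero hdet fun h => ?_, ?_⟩
    · simp [h] at htr
    · rw [trace_mul_self_fin_two, htr, hdet]
      norm_num
end
end
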